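/- Let R be a one-dimensional local commutative integral domain that is not a field. The following are equivalent: (a) R is stable; (b) R is finitely stable and the maximal ideal of R is stable; (c) R ⊆ R̄ is a quadratic extension and R̄ is a Dedekind domain with at most two maximal ideals. -/

import Mathlib

noncomputable section

open scoped nonZeroDivisors Pointwise

set_option synthInstance.maxHeartbeats 1000000
set_option maxHeartbeats 1000000

/-- For a nonzero ideal `I` of a domain `R`, viewed as a fractional ideal `J` of the quotient
field, the endomorphism ring `(I : I)` is `J / J` and `{z ∈ K | zI ⊆ (I : I)}` is `J / J / J`.
The ideal `I` is *stable* if it is invertible as an ideal of `(I : I)`, i.e.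
`I * ((I:I) : I) = (I:I)`. -/
def Ideal.IsStableIdeal {R : Type*} [CommRing R] [IsDomain R] (I : Ideal R) : Prop :=
  (I : FractionalIdeal R⁰ (FractionRing R)) *
      ((I : FractionalIdeal R⁰ (FractionRing R)) / (I : FractionalIdeal R⁰ (FractionRing R)) /
        (I : FractionalIdeal R⁰ (FractionRing R))) =
    (I : FractionalIdeal R⁰ (FractionRing R)) / (I : FractionalIdeal R⁰ (FractionRing R))

/-- A domain is *stable* if every nonzero ideal is stable. -/
def StableRing (R : Type*) [CommRing R] [IsDomain R] : Prop :=
  ∀ I : Ideal R, I ≠ ⊥ → I.IsStableIdeal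

/-- A domain is *finitely stable* if every nonzero finitely generated ideal is stable. -/
def FinitelyStableRing (R : Type*) [CommRing R] [IsDomain R] : Prop :=
  ∀ I : Ideal R, I ≠ ⊥ → I.FG → I.IsStableIdeal

/-- The extension `R ⊆ R̄` (integral closure inside the quotient field) is *quadratic* if
`xy ∈ xR + yR + R` for all `x, y ∈ R̄`. -/
def QuadraticClosureExtension (R : Type*) [CommRing R] [IsDomain R] : Prop :=
  ∀ x y : FractionRing R, x ∈ integralClosure R (FractionRing R) →
    y ∈ integralClosure R (FractionRing R) →
    ∃ a b c : R, x * y = algebraMap R (FractionRing R) a * x +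
      algebraMap R (FractionRing R) b * y + algebraMap R (FractionRing R) c


section Aux

set_option linter.unusedSectionVars false

variable {R : Type*} [CommRing R] {K : Type*} [Field K] [Algebra R K]

/-- Submodule version of stability. -/
def StabSub (I : Submodule R K) : Prop := (1 : K) ∈ I * (I / I / I)

lemma mem_ddiv {I : Submodule R K} {q : K} :
    q ∈ I / I / I ↔ ∀ a ∈ I, ∀ b ∈ I, q * a * b ∈ I := by
  simp only [Submodule.mem_div_iff_forall_mul_mem]

lemma stabSub_scale (d : K) (hd : d ≠ 0) (I I' : Submodule R K)
    (h : ∀ x, x ∈ I ↔ d * x ∈ I') (hs : StabSub I') : StabSub I := by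
  have key : ∀ z ∈ I' * (I' / I' / I'), z ∈ I * (I / I / I) := by
    intro z hz
    induction hz using Submodule.mul_induction_on' with
    | mem_mul_mem m hm q hq =>
      have h1 : d⁻¹ * m ∈ I := by
        rw [h]; rwa [mul_inv_cancel_left₀ hd]
      have h2 : d * q ∈ I / I / I := by
        rw [mem_ddiv] at hq ⊢
        intro a ha b hb
        rw [h] at ha hb ⊢
        have := hq _ ha _ hb
        convert this using 1; ring
      have := Submodule.mul_mem_mul h1 h2
      convert this using 1
      field_simp
    | add x _ y _ hx hy => exact add_mem hx hy
  exact key _ hs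

lemma stabSub_iff_eq (I : Submodule R K) : StabSub I ↔ I * (I / I / I) = I / I := by
  constructor
  · intro h
    apply le_antisymm
    · rw [Submodule.mul_le]
      intro m hm q hq
      rw [mem_ddiv] at hq
      rw [Submodule.mem_div_iff_forall_mul_mem]
      intro y hy
      rw [mul_comm m q]
      exact hq m hm y hy
    · intro z hz
      rw [Submodule.mem_div_iff_forall_mul_mem] at hz
      have key : ∀ w ∈ I * (I / I / I), z * w ∈ I * (I / I / I) := by
        intro w hw
        induction hw using Submodule.mul_induction_on' with
        | mem_mul_mem m hm q hq =>
          rw [← mul_assoc]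
          exact Submodule.mul_mem_mul (hz m hm) hq
        | add x _ y _ hx hy => rw [mul_add]; exact add_mem hx hy
      simpa using key 1 h
  · intro h
    unfold StabSub
    rw [h, Submodule.mem_div_iff_forall_mul_mem]
    intro y hy; simpa using hy

/-- local principal generator lemma -/
lemma loc_gen {S : Type*} [CommRing S] [IsDomain S] (N : Ideal S) [hN : N.IsPrime]
    (tot : ∀ y z : S, (∃ s, s ∉ N ∧ y ∣ s * z) ∨ (∃ s, s ∉ N ∧ z ∣ s * y))
    (x : S) (hx : x ∈ N) (hx0 : x ≠ 0)
    (hsq : ∀ y ∈ N, ∃ s, s ∉ N ∧ x ∣ s * y ^ 2) :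
    ∃ a ∈ N, ∀ c ∈ N, ∃ s, s ∉ N ∧ a ∣ s * c := by
  by_contra hcon
  push Not at hcon
  have step : ∀ a ∈ N, ∃ c ∈ N, ∃ t, t ∉ N ∧ ∃ p ∈ N, t * a = c * p := by
    intro a ha
    obtain ⟨c, hc, hac⟩ := hcon a ha
    refine ⟨c, hc, ?_⟩
    rcases tot a c with ⟨s, hs, h⟩ | ⟨s, hs, p, h⟩
    · exact absurd h (hac s hs)
    · refine ⟨s, hs, p, ?_, h⟩
      by_contra hp
      exact hac p hp ⟨s, by rw [mul_comm a s, h, mul_comm]⟩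
  obtain ⟨y, hy, s, hs, w, hw, hsx⟩ := step x hx
  have main : ∀ g g' : S, g ∈ N → s * x = g * g' → (∃ r, r ∉ N ∧ g ∣ r * g') → False := by
    rintro g g' hg h1 ⟨r, hr, p', h2⟩
    obtain ⟨z, hz, t, ht, p, hp, h3⟩ := step g hg
    obtain ⟨u, hu, v, h4⟩ := hsq z hz
    have h5 : x * (u * t ^ 2 * r * s) = x * (v * p ^ 2 * p') := by
      calc x * (u * t ^ 2 * r * s) = u * t ^ 2 * r * (s * x) := by ring
        _ = u * t ^ 2 * g * (r * g') := by rw [h1]; ring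
        _ = u * (t * g) ^ 2 * p' := by rw [h2]; ring
        _ = (u * z ^ 2) * p ^ 2 * p' := by rw [h3]; ring
        _ = _ := by rw [h4]; ring
    have h6 := mul_left_cancel₀ hx0 h5
    have h7 : u * t ^ 2 * r * s ∈ N := by
      rw [h6]
      exact N.mul_mem_right _ (N.mul_mem_left _ (N.pow_mem_of_mem hp 2 (by norm_num)))
    rcases hN.mem_or_mem h7 with h | h
    · rcases hN.mem_or_mem h with h | h
      · rcases hN.mem_or_mem h with h | h
        · exact hu h
        · exact ht (hN.mem_of_pow_mem _ h)
      · exact hr h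
    · exact hs h
  rcases tot y w with h | h
  · exact main y w hy hsx h
  · exact main w y hw (by rw [hsx, mul_comm]) h

variable [IsDomain R] [IsFractionRing R K]

/-- every f.g. nonzero submodule of K is stable -/
def FinStabSub (R K : Type*) [CommRing R] [Field K] [Algebra R K] : Prop :=
  ∀ I : Submodule R K, I ≠ ⊥ → I.FG → StabSub I

lemma isStableIdeal_iff (I : Ideal R) (hI : I ≠ ⊥) :
    I.IsStableIdeal ↔ StabSub (IsLocalization.coeSubmodule (FractionRing R) I) := by
  have h0 : (I : FractionalIdeal R⁰ (FractionRing R)) ≠ 0 := by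
    simpa using hI
  have hc : IsLocalization.coeSubmodule (FractionRing R) I =
      ((I : FractionalIdeal R⁰ (FractionRing R)) : Submodule R (FractionRing R)) := rfl
  rw [stabSub_iff_eq, Ideal.IsStableIdeal, hc,
    ← FractionalIdeal.coeToSubmodule_inj, FractionalIdeal.coe_mul,
    FractionalIdeal.coe_div h0, FractionalIdeal.coe_div h0]

lemma finStabSub_of (h : FinitelyStableRing R) : FinStabSub R (FractionRing R) := by
  intro I hI hfg
  obtain ⟨d, hd, hdI⟩ := FractionalIdeal.isFractional_of_fg (S := R⁰) hfg
  have hd0 : algebraMap R (FractionRing R) d ≠ 0 := by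
    simpa using nonZeroDivisors.ne_zero hd
  let I1 : Submodule R (FractionRing R) := I.map (LinearMap.mulLeft R (algebraMap R (FractionRing R) d))
  let I0 : Ideal R := Submodule.comap (Algebra.linearMap R (FractionRing R)) I1
  have hmap : Submodule.map (Algebra.linearMap R (FractionRing R)) I0 = I1 := by
    apply le_antisymm (Submodule.map_comap_le _ _)
    rintro _ ⟨x, hx, rfl⟩
    obtain ⟨r, hr⟩ := hdI x hx
    refine ⟨r, ?_, ?_⟩
    · change algebraMap R (FractionRing R) r ∈ I1
      rw [hr]; exact ⟨x, hx, by simp [Algebra.smul_def]⟩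
    · simp [hr, Algebra.smul_def]
  have hsc : ∀ x, x ∈ I ↔ algebraMap R (FractionRing R) d * x ∈ I1 := by
    intro x
    constructor
    · intro hx; exact ⟨x, hx, rfl⟩
    · rintro ⟨y, hy, hxy⟩
      have : y = x := mul_left_cancel₀ hd0 hxy
      exact this ▸ hy
  have hI0 : I0 ≠ ⊥ := by
    intro h0
    apply hI
    rw [h0, Submodule.map_bot] at hmap
    rw [eq_bot_iff]
    intro x hx
    have := (hsc x).1 hx
    rw [← hmap] at this
    simpa [hd0] using this
  have hI0fg : I0.FG := by
    apply Submodule.fg_of_fg_map_injective (Algebra.linearMap R (FractionRing R))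
    · exact IsFractionRing.injective R (FractionRing R)
    · rw [hmap]; exact hfg.map _
  have := (isStableIdeal_iff I0 hI0).1 (h I0 hI0 hI0fg)
  apply stabSub_scale _ hd0 I I1 hsc
  rw [← hmap]
  exact this

/-- scaled two-generator form -/
lemma two_gen (h : FinStabSub R K) (a b : K) (ha : a ≠ 0 ∨ b ≠ 0) :
    ∃ j j' : K, a * j + b * j' = 1 ∧
      ∀ q, q = j ∨ q = j' → ∀ c, c = a ∨ c = b → (IsIntegral R (q * c) ∧
        ∀ x ∈ Submodule.span R {a, b}, q * c * x ∈ Submodule.span R {a, b}) := by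
  set I : Submodule R K := Submodule.span R {a, b} with hIdef
  have haI : a ∈ I := Submodule.subset_span (by simp)
  have hbI : b ∈ I := Submodule.subset_span (by simp)
  have hI : I ≠ ⊥ := by
    rw [Submodule.ne_bot_iff]
    rcases ha with h | h
    · exact ⟨a, haI, h⟩
    · exact ⟨b, hbI, h⟩
  have hfg : I.FG := Submodule.fg_span (by simp)
  have hs := h I hI hfg
  have key : ∀ z ∈ I * (I / I / I), ∃ j ∈ I / I / I, ∃ j' ∈ I / I / I, a * j + b * j' = z := by
    intro z hz
    induction hz using Submodule.mul_induction_on' with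
    | mem_mul_mem m hm q hq =>
      rw [hIdef, Submodule.mem_span_pair] at hm
      obtain ⟨r, s, rfl⟩ := hm
      refine ⟨r • q, Submodule.smul_mem _ _ hq, s • q, Submodule.smul_mem _ _ hq, ?_⟩
      simp only [Algebra.smul_def]; ring
    | add x _ y _ hx hy =>
      obtain ⟨j, hj, j', hj', rfl⟩ := hx
      obtain ⟨k, hk, k', hk', rfl⟩ := hy
      exact ⟨j + k, add_mem hj hk, j' + k', add_mem hj' hk', by ring⟩
  obtain ⟨j, hj, j', hj', hjj⟩ := key 1 hs
  refine ⟨j, j', hjj, ?_⟩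
  intro q hq c hc
  have hq' : q ∈ I / I / I := by rcases hq with rfl | rfl <;> assumption
  have hc' : c ∈ I := by rcases hc with rfl | rfl <;> assumption
  have hx : ∀ x ∈ I, q * c * x ∈ I := fun x hx => mem_ddiv.1 hq' c hc' x hx
  exact ⟨isIntegral_of_smul_mem_submodule I hI hfg _ (by simpa using hx), hx⟩

lemma integral_one_of {I : Submodule R K} (hs : StabSub I) (h1 : (1 : K) ∈ I)
    (hI : ∀ x ∈ I, IsIntegral R x) : ∀ a ∈ I, ∀ b ∈ I, a * b ∈ I := by
  let E : Subalgebra R K :=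
    { carrier := {z | ∀ x ∈ I, z * x ∈ I}
      mul_mem' := by
        intro a b ha hb x hx
        rw [mul_assoc]; exact ha _ (hb _ hx)
      add_mem' := by
        intro a b ha hb x hx
        rw [add_mul]; exact add_mem (ha _ hx) (hb _ hx)
      algebraMap_mem' := by
        intro r x hx
        rw [← Algebra.smul_def]; exact Submodule.smul_mem _ _ hx }
  have hEI : ∀ e ∈ E, e ∈ I := fun e he => by simpa using he 1 h1
  have hES : E ≤ integralClosure R K := fun e he => hI e (hEI e he)
  let J : Ideal E :=
    { carrier := {z | (z : K) ∈ I / I / I}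
      add_mem' := by
        intro a b ha hb
        exact Submodule.add_mem (I / I / I) ha hb
      zero_mem' := Submodule.zero_mem (I / I / I)
      smul_mem' := by
        intro c x hx
        change ((c * x : E) : K) ∈ I / I / I
        rw [mem_ddiv]
        intro a ha b hb
        have := c.2 _ (mem_ddiv.1 hx a ha b hb)
        convert this using 1
        push_cast; ring }
  let f : E →+* integralClosure R K := (Subalgebra.inclusion hES).toRingHom
  have hfi : f.IsIntegral := by
    intro x
    have hx : IsIntegral R x := Algebra.IsIntegral.isIntegral x
    obtain ⟨p, hp, hpx⟩ := hx
    refine ⟨p.map (algebraMap R E), hp.map _, ?_⟩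
    rw [Polynomial.eval₂_map]
    exact hpx
  have hfinj : Function.Injective f := Subalgebra.inclusion_injective hES
  have hJ : J = ⊤ := by
    rw [← Ideal.map_eq_top_iff f hfinj hfi, Ideal.eq_top_iff_one]
    have key : ∀ z ∈ I * (I / I / I), ∃ w : integralClosure R K, (w : K) = z ∧ w ∈ J.map f := by
      intro z hz
      induction hz using Submodule.mul_induction_on' with
      | mem_mul_mem m hm q hq =>
        have hqE : q ∈ E := by
          intro x hx
          have := mem_ddiv.1 hq 1 h1 x hx
          simpa using this
        refine ⟨⟨m, hI m hm⟩ * f ⟨q, hqE⟩, rfl, ?_⟩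
        exact Ideal.mul_mem_left _ _ (Ideal.mem_map_of_mem f hq)
      | add x _ y _ hx hy =>
        obtain ⟨w, rfl, hw⟩ := hx
        obtain ⟨v, rfl, hv⟩ := hy
        exact ⟨w + v, rfl, add_mem hw hv⟩
    obtain ⟨w, hw, hwJ⟩ := key 1 hs
    have : w = 1 := Subtype.ext hw
    rwa [← this]
  have h1J : (1 : E) ∈ J := hJ ▸ Submodule.mem_top
  intro a ha b hb
  have := mem_ddiv.1 (show ((1 : E) : K) ∈ I / I / I from h1J) a ha b hb
  simpa using this

end Aux

section Main

set_option linter.unusedSectionVars false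

variable {R : Type*} [CommRing R] [IsDomain R] {K : Type*} [Field K] [Algebra R K]
  [IsFractionRing R K]

lemma pruf (h : FinStabSub R K) (N : Ideal (integralClosure R K)) [hN : N.IsPrime]
    (y z : integralClosure R K) :
    (∃ s, s ∉ N ∧ y ∣ s * z) ∨ (∃ s, s ∉ N ∧ z ∣ s * y) := by
  have h1N : (1 : integralClosure R K) ∉ N := fun h => hN.ne_top ((Ideal.eq_top_iff_one N).2 h)
  by_cases hz : z = 0
  · left; exact ⟨1, h1N, by simp [hz]⟩
  have hz' : (z : K) ≠ 0 := by simpa using hz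
  obtain ⟨j, j', hjj, hq⟩ := two_gen h (y : K) (z : K) (Or.inr hz')
  have i1 := (hq j (Or.inl rfl) y (Or.inl rfl)).1
  have i2 := (hq j (Or.inl rfl) z (Or.inr rfl)).1
  have i3 := (hq j' (Or.inr rfl) y (Or.inl rfl)).1
  have i4 := (hq j' (Or.inr rfl) z (Or.inr rfl)).1
  let e : integralClosure R K := ⟨j * y, i1⟩
  let e' : integralClosure R K := ⟨j' * z, i4⟩
  have hee : e + e' = 1 := by
    apply Subtype.ext
    change j * (y : K) + j' * z = 1
    rw [← hjj]; ring
  by_cases he : e ∈ N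
  · right
    refine ⟨e', fun he' => h1N (hee ▸ add_mem he he'), ⟨j' * y, i3⟩, ?_⟩
    apply Subtype.ext
    change j' * (z : K) * y = z * (j' * y)
    ring
  · left
    refine ⟨e, he, ⟨j * z, i2⟩, ?_⟩
    apply Subtype.ext
    change j * (y : K) * z = y * (j * z)
    ring

lemma compl_int (h : FinStabSub R K) [Ring.DimensionLEOne R] (z : K) (m : R) (hm : m ≠ 0)
    (hz : ∀ n : ℕ, IsIntegral R (z ^ n * algebraMap R K m)) : IsIntegral R z := by
  by_contra hcon
  obtain ⟨j, j', hjj, hq⟩ := two_gen h (1 : K) z (Or.inl one_ne_zero)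
  have i1 := (hq j (Or.inl rfl) 1 (Or.inl rfl)).1
  have i2 := (hq j (Or.inl rfl) z (Or.inr rfl)).1
  have i3 := (hq j' (Or.inr rfl) 1 (Or.inl rfl)).1
  have i4 := (hq j' (Or.inr rfl) z (Or.inr rfl)).1
  rw [mul_one] at i1 i3
  let A : Ideal (integralClosure R K) :=
    { carrier := {s | IsIntegral R ((s : K) * z)}
      add_mem' := by
        intro a b ha hb
        have := IsIntegral.add ha hb
        rw [← add_mul] at this
        exact this
      zero_mem' := by
        change IsIntegral R (((0 : integralClosure R K) : K) * z)
        simpa using isIntegral_zero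
      smul_mem' := by
        intro c x hx
        have := IsIntegral.mul c.2 hx
        rw [← mul_assoc] at this
        exact this }
  have hA : A ≠ ⊤ := by
    intro hA
    have : (1 : integralClosure R K) ∈ A := hA ▸ Submodule.mem_top
    apply hcon
    have h2 : IsIntegral R (((1 : integralClosure R K) : K) * z) := this
    simpa using h2
  obtain ⟨N, hN, hAN⟩ := Ideal.exists_le_maximal A hA
  have hNp := hN.isPrime
  let k : integralClosure R K := ⟨j, i1⟩
  let k' : integralClosure R K := ⟨j', i3⟩
  let s : integralClosure R K := ⟨j' * z, i4⟩
  have hk : k ∈ N := hAN i2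
  have hk' : k' ∈ N := hAN i4
  have hks : k + s = 1 := by
    apply Subtype.ext
    change j + j' * z = 1
    rw [← hjj]; ring
  have h1N : (1 : integralClosure R K) ∉ N := fun h => hNp.ne_top ((Ideal.eq_top_iff_one N).2 h)
  have hs : s ∉ N := fun hs => h1N (hks ▸ add_mem hk hs)
  let mm : integralClosure R K := algebraMap R _ m
  have hmm : mm ≠ 0 := by
    intro h0
    have : algebraMap R K m = 0 := congrArg (fun t : integralClosure R K => (t : K)) h0
    exact hm ((map_eq_zero_iff _ (IsFractionRing.injective R K)).1 this)
  obtain ⟨u, hu, n, c, huc⟩ : ∃ u, u ∉ N ∧ ∃ n : ℕ, ∃ c, u * k' ^ n = mm * c := by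
    by_contra hno
    push Not at hno
    let T : Submonoid (integralClosure R K) := N.primeCompl ⊔ Submonoid.powers k'
    have hdis : Disjoint ((Ideal.span {mm} : Ideal (integralClosure R K)) : Set (integralClosure R K))
        (T : Set (integralClosure R K)) := by
      rw [Set.disjoint_left]
      intro x hx hxT
      obtain ⟨u, hu, v, ⟨n, rfl⟩, rfl⟩ := Submonoid.mem_sup.1 hxT
      obtain ⟨c, hc⟩ := Ideal.mem_span_singleton.1 hx
      exact hno u hu n c hc
    obtain ⟨P, hP, hmP, hPT⟩ := Ideal.exists_le_prime_disjoint _ T hdis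
    have hPN : P ≤ N := by
      intro x hx
      by_contra hxN
      exact Set.disjoint_left.1 hPT hx (Submonoid.mem_sup_left hxN)
    have hPb : P ≠ ⊥ := by
      intro hb
      have : mm ∈ P := hmP (Ideal.mem_span_singleton_self mm)
      rw [hb] at this
      exact hmm this
    have hPm : P.IsMaximal := hP.isMaximal hPb
    have hPN' : P = N := hPm.eq_of_le hN.ne_top hPN
    exact Set.disjoint_left.1 hPT (show k' ∈ P from hPN' ▸ hk')
      (Submonoid.mem_sup_right (Submonoid.mem_powers k'))
  let w : integralClosure R K := ⟨_, hz (n + 1)⟩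
  have e1 : s ^ (n + 1) * mm = k' ^ (n + 1) * w := by
    apply Subtype.ext
    change (j' * z) ^ (n + 1) * algebraMap R K m = j' ^ (n + 1) * (z ^ (n + 1) * algebraMap R K m)
    ring
  have e2 : mm * (u * s ^ (n + 1)) = mm * (c * k' * w) := by
    calc mm * (u * s ^ (n + 1)) = u * (s ^ (n + 1) * mm) := by ring
      _ = (u * k' ^ n) * k' * w := by rw [e1]; ring
      _ = _ := by rw [huc]; ring
  have e3 := mul_left_cancel₀ hmm e2
  have e4 : u * s ^ (n + 1) ∈ N := by
    rw [e3]; exact N.mul_mem_right _ (N.mul_mem_left _ hk')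
  rcases hNp.mem_or_mem e4 with h | h
  · exact hu h
  · exact hs (hNp.mem_of_pow_mem _ h)

variable [IsLocalRing R]

lemma mem_max_iff (N : Ideal (integralClosure R K)) [hN : N.IsMaximal] (r : R) :
    algebraMap R (integralClosure R K) r ∈ N ↔ r ∈ IsLocalRing.maximalIdeal R := by
  have h1 : (N.comap (algebraMap R (integralClosure R K))).IsMaximal :=
    Ideal.isMaximal_comap_of_isIntegral_of_isMaximal N
  rw [← IsLocalRing.eq_maximalIdeal h1, Ideal.mem_comap]

lemma no_three (h : FinStabSub R K) (N₁ N₂ N₃ : Ideal (integralClosure R K))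
    [h₁ : N₁.IsMaximal] [h₂ : N₂.IsMaximal] [h₃ : N₃.IsMaximal]
    (h12 : N₁ ≠ N₂) (h13 : N₁ ≠ N₃) (h23 : N₂ ≠ N₃) : False := by
  have p₁ := h₁.isPrime
  have p₂ := h₂.isPrime
  have p₃ := h₃.isPrime
  obtain ⟨a, ha1, ha2, ha3⟩ : ∃ a, a ∈ N₁ ∧ a ∉ N₂ ∧ a ∉ N₃ := by
    by_contra hno
    push Not at hno
    have : (N₁ : Set (integralClosure R K)) ⊆ N₂ ∪ N₃ := by
      intro x hx
      by_cases hx2 : x ∈ N₂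
      · exact Or.inl hx2
      · exact Or.inr (hno x hx hx2)
    rcases Ideal.subset_union.1 this with h | h
    · exact h12 (h₁.eq_of_le h₂.ne_top h)
    · exact h13 (h₁.eq_of_le h₃.ne_top h)
  obtain ⟨b, hb2, hb1, hb3⟩ : ∃ a, a ∈ N₂ ∧ a ∉ N₁ ∧ a ∉ N₃ := by
    by_contra hno
    push Not at hno
    have : (N₂ : Set (integralClosure R K)) ⊆ N₁ ∪ N₃ := by
      intro x hx
      by_cases hx2 : x ∈ N₁
      · exact Or.inl hx2
      · exact Or.inr (hno x hx hx2)
    rcases Ideal.subset_union.1 this with h | h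
    · exact h12 (h₂.eq_of_le h₁.ne_top h).symm
    · exact h23 (h₂.eq_of_le h₃.ne_top h)
  have ha0 : (a : K) ≠ 0 := by
    intro h0
    have : a = 0 := Subtype.ext h0
    exact ha2 (this ▸ N₂.zero_mem)
  obtain ⟨j, j', hjj, hq⟩ := two_gen h (a : K) (b : K) (Or.inl ha0)
  obtain ⟨i1, hE⟩ := hq j (Or.inl rfl) a (Or.inl rfl)
  have i2 := (hq j (Or.inl rfl) b (Or.inr rfl)).1
  have i3 := (hq j' (Or.inr rfl) a (Or.inl rfl)).1
  let e : integralClosure R K := ⟨j * a, i1⟩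
  have e1 : e * b = a * ⟨j * b, i2⟩ := by
    apply Subtype.ext
    change j * (a : K) * b = a * (j * b)
    ring
  have e2 : (1 - e) * a = b * ⟨j' * a, i3⟩ := by
    apply Subtype.ext
    change (1 - j * (a : K)) * a = b * (j' * a)
    rw [← hjj]; ring
  have he1 : e ∈ N₁ :=
    (p₁.mem_or_mem (show e * b ∈ N₁ from e1 ▸ N₁.mul_mem_right _ ha1)).resolve_right hb1
  have he2 : 1 - e ∈ N₂ :=
    (p₂.mem_or_mem (show (1 - e) * a ∈ N₂ from e2 ▸ N₂.mul_mem_right _ hb2)).resolve_right ha2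
  obtain ⟨r, s, hrs⟩ := Submodule.mem_span_pair.1
    (hE (a : K) (Submodule.subset_span (by simp)))
  obtain ⟨r', s', hrs'⟩ := Submodule.mem_span_pair.1
    (hE (b : K) (Submodule.subset_span (by simp)))
  let A := algebraMap R (integralClosure R K)
  have f1 : A r * a + A s * b = e * a := by
    apply Subtype.ext
    simp only [Algebra.smul_def] at hrs
    exact hrs
  have f2 : A r' * a + A s' * b = e * b := by
    apply Subtype.ext
    simp only [Algebra.smul_def] at hrs'
    exact hrs'
  have tr : ∀ (N N' : Ideal (integralClosure R K)) [N.IsMaximal] [N'.IsMaximal] (t : R),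
      A t ∈ N → A t ∈ N' := fun N N' _ _ t ht =>
    (mem_max_iff N' t).2 ((mem_max_iff N t).1 ht)
  have s1 : A s ∈ N₁ := by
    have : A s * b ∈ N₁ := by
      have : A s * b = (e - A r) * a := by linear_combination f1
      rw [this]; exact N₁.mul_mem_left _ ha1
    exact (p₁.mem_or_mem this).resolve_right hb1
  have r2 : e - A r ∈ N₂ := by
    have : (e - A r) * a ∈ N₂ := by
      have : (e - A r) * a = A s * b := by linear_combination -f1
      rw [this]; exact N₂.mul_mem_left _ hb2
    exact (p₂.mem_or_mem this).resolve_right ha2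
  have r2' : A (1 - r) ∈ N₂ := by
    have : A (1 - r) = (1 - e) + (e - A r) := by rw [map_sub, map_one]; ring
    rw [this]; exact add_mem he2 r2
  have r3 : e - A r ∈ N₃ := by
    have : (e - A r) * a ∈ N₃ := by
      have : (e - A r) * a = A s * b := by linear_combination -f1
      rw [this]; exact N₃.mul_mem_right _ (tr N₁ N₃ s s1)
    exact (p₃.mem_or_mem this).resolve_right ha3
  have sp1 : A s' ∈ N₁ := by
    have : A s' * b ∈ N₁ := by
      have : A s' * b = e * b - A r' * a := by linear_combination f2
      rw [this]; exact sub_mem (N₁.mul_mem_right _ he1) (N₁.mul_mem_left _ ha1)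
    exact (p₁.mem_or_mem this).resolve_right hb1
  have rp2 : A r' ∈ N₂ := by
    have : A r' * a ∈ N₂ := by
      have : A r' * a = (e - A s') * b := by linear_combination f2
      rw [this]; exact N₂.mul_mem_left _ hb2
    exact (p₂.mem_or_mem this).resolve_right ha2
  have e3 : e ∈ N₃ := by
    have : e * b ∈ N₃ := by
      rw [← f2]
      exact add_mem (N₃.mul_mem_right _ (tr N₂ N₃ r' rp2)) (N₃.mul_mem_right _ (tr N₁ N₃ s' sp1))
    exact (p₃.mem_or_mem this).resolve_right hb3
  apply p₃.ne_top
  rw [Ideal.eq_top_iff_one]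
  have : (1 : integralClosure R K) = A (1 - r) - (e - A r) + e := by rw [map_sub, map_one]; ring
  rw [this]
  exact add_mem (sub_mem (tr N₂ N₃ _ r2') r3) e3

lemma exists_locx (h : FinStabSub R K) [Ring.DimensionLEOne R]
    (hM0 : IsLocalRing.maximalIdeal R ≠ ⊥)
    (hM : StabSub (IsLocalization.coeSubmodule K (IsLocalRing.maximalIdeal R)))
    (N : Ideal (integralClosure R K)) [hN : N.IsMaximal] :
    ∃ x ∈ IsLocalRing.maximalIdeal R, x ≠ 0 ∧ ∀ m ∈ IsLocalRing.maximalIdeal R, ∃ s, s ∉ N ∧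
      algebraMap R (integralClosure R K) x ∣ s * algebraMap R (integralClosure R K) m := by
  set M := IsLocalRing.maximalIdeal R with hMdef
  set M' := IsLocalization.coeSubmodule K M with hM'
  have hintg : ∀ z : K, (∀ a ∈ M', z * a ∈ M') → IsIntegral R z := by
    intro z hz
    obtain ⟨m, hm, hm0⟩ := (Submodule.ne_bot_iff _).1 hM0
    apply compl_int h z m hm0
    intro n
    have : z ^ n * algebraMap R K m ∈ M' := by
      induction n with
      | zero =>
        rw [pow_zero, one_mul]
        exact (IsLocalization.mem_coeSubmodule K M).2 ⟨m, hm, rfl⟩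
      | succ n ih =>
        have := hz _ ih
        convert this using 1
        ring
    obtain ⟨y, _, hy⟩ := (IsLocalization.mem_coeSubmodule K M).1 this
    rw [← hy]; exact isIntegral_algebraMap
  have hq : ∀ q ∈ M' / M' / M', ∀ a ∈ M', IsIntegral R (q * a) := by
    intro q hq a ha
    exact hintg _ (fun b hb => mem_ddiv.1 hq a ha b hb)
  by_contra hno
  push Not at hno
  have key : ∀ z ∈ M' * (M' / M' / M'), ∃ w ∈ N, (w : K) = z := by
    intro z hz
    induction hz using Submodule.mul_induction_on' with
    | mem_mul_mem m hm q hqq =>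
      refine ⟨⟨m * q, mul_comm q m ▸ hq q hqq m hm⟩, ?_, rfl⟩
      by_contra hw
      obtain ⟨x, hx, rfl⟩ := (IsLocalization.mem_coeSubmodule K M).1 hm
      have hx0 : x ≠ 0 := by
        rintro rfl
        apply hw
        convert N.zero_mem
        simp
      obtain ⟨m, hmM, hmm⟩ := hno x hx hx0
      apply hmm _ hw
      have hm' : algebraMap R K m ∈ M' := (IsLocalization.mem_coeSubmodule K M).2 ⟨m, hmM, rfl⟩
      refine ⟨⟨_, hq q hqq _ hm'⟩, ?_⟩
      apply Subtype.ext
      change algebraMap R K x * q * algebraMap R K m = algebraMap R K x * (q * algebraMap R K m)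
      ring
    | add x _ y _ hx hy =>
      obtain ⟨w, hw, rfl⟩ := hx
      obtain ⟨v, hv, rfl⟩ := hy
      exact ⟨w + v, add_mem hw hv, rfl⟩
  obtain ⟨w, hw, hw1⟩ := key 1 hM
  have : w = 1 := Subtype.ext hw1
  exact hN.ne_top ((Ideal.eq_top_iff_one N).2 (this ▸ hw))

lemma exists_locgen (h : FinStabSub R K) [Ring.DimensionLEOne R]
    (hquad : ∀ x y : integralClosure R K, ∃ a b c : R, x * y =
      algebraMap R (integralClosure R K) a * x + algebraMap R (integralClosure R K) b * y
       + algebraMap R (integralClosure R K) c)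
    (hM0 : IsLocalRing.maximalIdeal R ≠ ⊥)
    (hM : StabSub (IsLocalization.coeSubmodule K (IsLocalRing.maximalIdeal R)))
    (N : Ideal (integralClosure R K)) [hN : N.IsMaximal] :
    ∃ a ∈ N, ∀ c ∈ N, ∃ s, s ∉ N ∧ a ∣ s * c := by
  have hNp := hN.isPrime
  obtain ⟨x, hx, hx0, hxm⟩ := exists_locx h hM0 hM N
  let A := algebraMap R (integralClosure R K)
  have hA : Function.Injective A := by
    intro a b hab
    exact IsFractionRing.injective R K (congrArg (fun t : integralClosure R K => (t : K)) hab)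
  apply loc_gen N (pruf h N) (A x) ((mem_max_iff N x).2 hx)
    (by rwa [Ne, map_eq_zero_iff A hA])
  intro y hy
  obtain ⟨a, b, c, habc⟩ := hquad y y
  have habc' : y * (y - A (a + b)) = A c := by
    rw [map_add]; linear_combination habc
  have hc : c ∈ IsLocalRing.maximalIdeal R := by
    rw [← mem_max_iff N]
    change A c ∈ N
    rw [← habc']; exact N.mul_mem_right _ hy
  obtain ⟨s, hs, t, hst⟩ := hxm c hc
  by_cases hab : a + b ∈ IsLocalRing.maximalIdeal R
  · obtain ⟨s', hs', t', hst'⟩ := hxm _ hab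
    refine ⟨s * s', fun hh => (hNp.mem_or_mem hh).elim hs hs', s * t' * y + s' * t, ?_⟩
    have e1 : y ^ 2 = A (a + b) * y + A c := by rw [← habc']; ring
    have e2 : s * A c = A x * t := hst
    have e3 : s' * A (a + b) = A x * t' := hst'
    rw [e1]
    linear_combination s' * e2 + s * y * e3
  · refine ⟨s * (y - A (a + b)), fun hh => ?_, t * y, ?_⟩
    · rcases hNp.mem_or_mem hh with hh | hh
      · exact hs hh
      · apply hab
        rw [← mem_max_iff N]
        have := sub_mem hy hh
        simpa using this
    · have e2 : s * A c = A x * t := hst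
      linear_combination s * y * habc' + y * e2

lemma quad_of (h : FinStabSub R K) (x y : K) (hx : IsIntegral R x) (hy : IsIntegral R y) :
    ∃ a b c : R, x * y = algebraMap R K a * x + algebraMap R K b * y + algebraMap R K c := by
  let I : Submodule R K := Submodule.span R {x, y, 1}
  have hxI : x ∈ I := Submodule.subset_span (by simp)
  have hyI : y ∈ I := Submodule.subset_span (by simp)
  have h1I : (1 : K) ∈ I := Submodule.subset_span (by simp)
  have hI : I ≠ ⊥ := (Submodule.ne_bot_iff _).2 ⟨1, h1I, one_ne_zero⟩
  have hs : StabSub I := h I hI (Submodule.fg_span (by simp))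
  have hintg : ∀ z ∈ I, IsIntegral R z := by
    intro z hz
    have : I ≤ Subalgebra.toSubmodule (integralClosure R K) := by
      rw [Submodule.span_le]
      rintro t (rfl | rfl | rfl)
      · exact hx
      · exact hy
      · exact isIntegral_one
    exact this hz
  have := integral_one_of hs h1I hintg x hxI y hyI
  obtain ⟨a, b, c, habc⟩ := Submodule.mem_span_triple.1 this
  refine ⟨a, b, c, ?_⟩
  rw [← habc]; simp [Algebra.smul_def]

lemma b_to_c [Ring.DimensionLEOne R] (h : FinStabSub R K)
    (hM0 : IsLocalRing.maximalIdeal R ≠ ⊥)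
    (hM : StabSub (IsLocalization.coeSubmodule K (IsLocalRing.maximalIdeal R))) :
    IsDedekindDomain (integralClosure R K) ∧
        ∃ m₁ m₂ : Ideal (integralClosure R K),
          ∀ m : Ideal (integralClosure R K), m.IsMaximal → m = m₁ ∨ m = m₂ := by
  have htwo : ∃ m₁ m₂ : Ideal (integralClosure R K),
          ∀ m : Ideal (integralClosure R K), m.IsMaximal → m = m₁ ∨ m = m₂ := by
    by_contra hno
    push Not at hno
    obtain ⟨m₁, hm₁⟩ := Ideal.exists_maximal (integralClosure R K)
    obtain ⟨m₂, hm₂, h21, -⟩ := hno m₁ m₁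
    obtain ⟨m₃, hm₃, h31, h32⟩ := hno m₁ m₂
    exact no_three h m₁ m₂ m₃ h21.symm h31.symm h32.symm
  refine ⟨?_, htwo⟩
  have hdim : Ring.DimensionLEOne (integralClosure R K) := inferInstance
  have hquad : ∀ x y : integralClosure R K, ∃ a b c : R, x * y =
      algebraMap R (integralClosure R K) a * x + algebraMap R (integralClosure R K) b * y
       + algebraMap R (integralClosure R K) c := by
    intro x y
    obtain ⟨a, b, c, habc⟩ := quad_of h x y x.2 y.2
    exact ⟨a, b, c, Subtype.ext habc⟩
  have hnoeth : IsNoetherianRing (integralClosure R K) := by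
    apply IsNoetherianRing.of_prime_ne_bot
    intro N hNp hNb
    have hN : N.IsMaximal := hNp.isMaximal hNb
    obtain ⟨a, ha, hac⟩ := exists_locgen h hquad hM0 hM N
    obtain ⟨b, hb, hbN⟩ : ∃ b ∈ N, ∀ N' : Ideal (integralClosure R K), N'.IsMaximal → N' ≠ N →
        b ∉ N' := by
      by_cases hex : ∃ N' : Ideal (integralClosure R K), N'.IsMaximal ∧ N' ≠ N
      · obtain ⟨N', hN', hne⟩ := hex
        have : ¬ N ≤ N' := fun hle => hne (hN.eq_of_le hN'.ne_top hle).symm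
        obtain ⟨b, hb, hb'⟩ := SetLike.not_le_iff_exists.1 this
        refine ⟨b, hb, fun N'' hN'' hne'' => ?_⟩
        obtain ⟨m₁, m₂, h12⟩ := htwo
        have : N'' = N' := by
          rcases h12 N hN with h1 | h1 <;> rcases h12 N' hN' with h2 | h2 <;>
            rcases h12 N'' hN'' with h3 | h3 <;> simp_all
        rwa [this]
      · exact ⟨0, N.zero_mem, fun N' hN' hne => absurd ⟨N', hN', hne⟩ hex⟩
    have : N = Ideal.span {a, b} := by
      apply le_antisymm
      · intro c hc
        let C : Ideal (integralClosure R K) := Submodule.comap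
          (LinearMap.mulRight (integralClosure R K) c) (Ideal.span {a, b})
        have hC : C = ⊤ := by
          by_contra hCt
          obtain ⟨P, hP, hCP⟩ := Ideal.exists_le_maximal C hCt
          by_cases hPN : P = N
          · obtain ⟨s, hs, t, hst⟩ := hac c hc
            apply hs
            rw [← hPN]
            apply hCP
            change s * c ∈ Ideal.span {a, b}
            rw [hst]
            exact Ideal.mul_mem_right _ _ (Ideal.subset_span (by simp))
          · apply hbN P hP hPN
            apply hCP
            change b * c ∈ Ideal.span {a, b}
            exact Ideal.mul_mem_right _ _ (Ideal.subset_span (by simp))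
        have h1 : (1 : integralClosure R K) ∈ C := hC ▸ Submodule.mem_top
        have h2 : 1 * c ∈ Ideal.span {a, b} := h1
        simpa using h2
      · rw [Ideal.span_le]
        rintro t (rfl | rfl)
        · exact ha
        · exact hb
    rw [this]
    exact Submodule.fg_span (by simp)
  have halg : Algebra.IsAlgebraic R K := IsLocalization.isAlgebraic K R⁰
  have hfrac : IsFractionRing (integralClosure R K) K :=
    IsIntegralClosure.isFractionRing_of_algebraic (A := R) (C := integralClosure R K) (L := K)
      (fun x hx => (map_eq_zero_iff _ (IsFractionRing.injective R K)).1 hx)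
  rw [isDedekindDomain_iff (integralClosure R K) K]
  refine ⟨inferInstance, hnoeth, hdim, ?_⟩
  intro x hx
  have : IsIntegral R x := isIntegral_trans (A := integralClosure R K) x hx
  exact ⟨⟨x, this⟩, rfl⟩

lemma c_to_a (hD : IsDedekindDomain (integralClosure R K))
    (hquad : ∀ x y : K, IsIntegral R x → IsIntegral R y →
      ∃ a b c : R, x * y = algebraMap R K a * x + algebraMap R K b * y + algebraMap R K c)
    (m₁ m₂ : Ideal (integralClosure R K))
    (hm : ∀ m : Ideal (integralClosure R K), m.IsMaximal → m = m₁ ∨ m = m₂)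
    (I : Ideal R) (hI : I ≠ ⊥) : StabSub (IsLocalization.coeSubmodule K I) := by
  let A := algebraMap R (integralClosure R K)
  have hA : Function.Injective A := by
    intro a b hab
    exact IsFractionRing.injective R K (congrArg (fun t : integralClosure R K => (t : K)) hab)
  have hfin : {J : Ideal (integralClosure R K) | J.IsMaximal}.Finite :=
    Set.Finite.subset (Set.toFinite {m₁, m₂}) (fun J hJ => by simpa using hm J hJ)
  have hpid : IsPrincipalIdealRing (integralClosure R K) :=
    IsPrincipalIdealRing.of_finite_maximals hfin
  obtain ⟨u, hu⟩ := (hpid.principal (I.map A)).principal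
  change I.map A = Ideal.span {u} at hu
  have hu0 : u ≠ 0 := by
    rintro rfl
    obtain ⟨x, hx, hx0⟩ := (Submodule.ne_bot_iff _).1 hI
    have : A x ∈ I.map A := Ideal.mem_map_of_mem A hx
    rw [hu] at this
    simp only [Ideal.span_singleton_zero] at this
    exact hx0 ((map_eq_zero_iff A hA).1 this)
  have hdiv : ∀ x ∈ I, ∃ v, A x = u * v := by
    intro x hx
    have : A x ∈ I.map A := Ideal.mem_map_of_mem A hx
    rw [hu] at this
    exact Ideal.mem_span_singleton.1 this
  -- for each maximal ideal there is an element of `I` that generates locally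
  have hloc : ∀ N : Ideal (integralClosure R K), N.IsMaximal → ∃ x ∈ I, ∃ v, A x = u * v ∧ v ∉ N := by
    intro N hN
    by_contra hno
    push Not at hno
    have h1 : I.map A ≤ Ideal.span {u} * N := by
      rw [Ideal.map_le_iff_le_comap]
      intro x hx
      obtain ⟨v, hv⟩ := hdiv x hx
      have := hno x hx v hv
      rw [Ideal.mem_comap, hv]
      exact Ideal.mul_mem_mul (Ideal.mem_span_singleton_self u) this
    rw [hu] at h1
    have h2 := h1 (Ideal.mem_span_singleton_self u)
    rw [Ideal.mem_span_singleton_mul] at h2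
    obtain ⟨z, hz, hzu⟩ := h2
    have : z = 1 := mul_left_cancel₀ hu0 (by rw [hzu, mul_one])
    exact hN.ne_top ((Ideal.eq_top_iff_one N).2 (this ▸ hz))
  obtain ⟨w, hwI, v, hwv, hv⟩ : ∃ w ∈ I, ∃ v, A w = u * v ∧ IsUnit v := by
    have hunit : ∀ v : integralClosure R K, (∀ N : Ideal (integralClosure R K), N.IsMaximal → v ∉ N) → IsUnit v := by
      intro v hv
      by_contra hnu
      obtain ⟨N, hN, hvN⟩ := exists_max_ideal_of_mem_nonunits hnu
      exact hv N hN hvN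
    obtain ⟨N₁, hN₁⟩ := Ideal.exists_maximal (integralClosure R K)
    obtain ⟨x, hx, a, hxa, ha⟩ := hloc N₁ hN₁
    by_cases hau : IsUnit a
    · exact ⟨x, hx, a, hxa, hau⟩
    obtain ⟨N₂, hN₂, haN₂⟩ := exists_max_ideal_of_mem_nonunits hau
    obtain ⟨y, hy, b, hyb, hb⟩ := hloc N₂ hN₂
    by_cases hbu : IsUnit b
    · exact ⟨y, hy, b, hyb, hbu⟩
    have hne : N₁ ≠ N₂ := by rintro rfl; exact ha haN₂
    have hall : ∀ N : Ideal (integralClosure R K), N.IsMaximal → N = N₁ ∨ N = N₂ := by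
      intro N hN
      rcases hm N₁ hN₁ with h1 | h1 <;> rcases hm N₂ hN₂ with h2 | h2 <;>
            rcases hm N hN with h3 | h3 <;> simp_all
    obtain ⟨N₃, hN₃, hbN₃⟩ := exists_max_ideal_of_mem_nonunits hbu
    have hb1 : b ∈ N₁ := by
      rcases hall N₃ hN₃ with h | h
      · exact h ▸ hbN₃
      · exact absurd (h ▸ hbN₃) hb
    refine ⟨x + y, add_mem hx hy, a + b, by rw [map_add, hxa, hyb]; ring, hunit _ ?_⟩
    intro N hN hab
    rcases hall N hN with rfl | rfl
    · exact ha (by simpa using sub_mem hab hb1)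
    · exact hb (by simpa using sub_mem hab haN₂)
  obtain ⟨v', hvv'⟩ := hv.exists_right_inv
  have hw0 : algebraMap R K w ≠ 0 := by
    intro h0
    have h1 : A w = 0 := Subtype.ext h0
    rw [hwv] at h1
    rcases mul_eq_zero.1 h1 with h | h
    · exact hu0 h
    · exact hv.ne_zero h
  have hquo : ∀ x ∈ I, IsIntegral R (algebraMap R K x / algebraMap R K w) := by
    intro x hx
    obtain ⟨t, ht⟩ := hdiv x hx
    have h1 : A x = A w * (v' * t) := by
      rw [ht, hwv]; linear_combination (-u * t) * hvv'
    have h2 : algebraMap R K x = algebraMap R K w * ((v' * t : integralClosure R K) : K) :=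
      congrArg (fun t : integralClosure R K => (t : K)) h1
    rw [h2, mul_div_cancel_left₀ _ hw0]
    exact (v' * t).2
  have hwm : algebraMap R K w ∈ IsLocalization.coeSubmodule K I :=
    (IsLocalization.mem_coeSubmodule K I).2 ⟨w, hwI, rfl⟩
  have hinv : (algebraMap R K w)⁻¹ ∈ IsLocalization.coeSubmodule K I /
      IsLocalization.coeSubmodule K I / IsLocalization.coeSubmodule K I := by
    rw [mem_ddiv]
    intro a ha b hb
    obtain ⟨x, hx, rfl⟩ := (IsLocalization.mem_coeSubmodule K I).1 ha
    obtain ⟨y, hy, rfl⟩ := (IsLocalization.mem_coeSubmodule K I).1 hb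
    obtain ⟨r, s, t, h⟩ := hquad _ _ (hquo x hx) (hquo y hy)
    refine (IsLocalization.mem_coeSubmodule K I).2 ⟨r * x + s * y + t * w, ?_, ?_⟩
    · exact add_mem (add_mem (I.mul_mem_left _ hx) (I.mul_mem_left _ hy)) (I.mul_mem_left _ hwI)
    · simp only [map_add, map_mul]
      field_simp at h ⊢
      linear_combination -h
  have := Submodule.mul_mem_mul hwm hinv
  rw [mul_inv_cancel₀ hw0] at this
  exact this

end Main

theorem one_dimensional_local_stable_tfae (R : Type*) [CommRing R] [IsDomain R] [IsLocalRing R]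
    (hR : ¬ IsField R) (hdim : ringKrullDim R = 1) :
    (StableRing R ↔
      (FinitelyStableRing R ∧ (IsLocalRing.maximalIdeal R).IsStableIdeal)) ∧
    ((FinitelyStableRing R ∧ (IsLocalRing.maximalIdeal R).IsStableIdeal) ↔
      (QuadraticClosureExtension R ∧
        IsDedekindDomain ↥(integralClosure R (FractionRing R)) ∧
        ∃ m₁ m₂ : Ideal ↥(integralClosure R (FractionRing R)),
          ∀ m : Ideal ↥(integralClosure R (FractionRing R)), m.IsMaximal → m = m₁ ∨ m = m₂)) := by
  have hM0 : IsLocalRing.maximalIdeal R ≠ ⊥ := by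
    intro h
    exact hR (IsLocalRing.isField_iff_maximalIdeal_eq.2 h)
  have hdim1 : Ring.DimensionLEOne R := by
    have h1 : Ring.KrullDimLE 1 R := by
      rw [Ring.krullDimLE_iff, hdim]; rfl
    have h2 := Ring.krullDimLE_one_iff_of_isPrime_bot.1 h1
    exact ⟨fun {p} hp hpp => h2 p hp hpp⟩
  have hbc : (FinitelyStableRing R ∧ (IsLocalRing.maximalIdeal R).IsStableIdeal) →
      (QuadraticClosureExtension R ∧
        IsDedekindDomain ↥(integralClosure R (FractionRing R)) ∧
        ∃ m₁ m₂ : Ideal ↥(integralClosure R (FractionRing R)),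
          ∀ m : Ideal ↥(integralClosure R (FractionRing R)), m.IsMaximal → m = m₁ ∨ m = m₂) := by
    rintro ⟨hf, hs⟩
    have hf' := finStabSub_of hf
    refine ⟨?_, b_to_c hf' hM0 ((isStableIdeal_iff _ hM0).1 hs)⟩
    intro x y hx hy
    exact quad_of hf' x y hx hy
  have hca : (QuadraticClosureExtension R ∧
        IsDedekindDomain ↥(integralClosure R (FractionRing R)) ∧
        ∃ m₁ m₂ : Ideal ↥(integralClosure R (FractionRing R)),
          ∀ m : Ideal ↥(integralClosure R (FractionRing R)), m.IsMaximal → m = m₁ ∨ m = m₂) →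
      StableRing R := by
    rintro ⟨hq, hD, m₁, m₂, hm⟩ I hI
    exact (isStableIdeal_iff I hI).2 (c_to_a hD hq m₁ m₂ hm I hI)
  have hab : StableRing R →
      (FinitelyStableRing R ∧ (IsLocalRing.maximalIdeal R).IsStableIdeal) :=
    fun h => ⟨fun I hI _ => h I hI, h _ hM0⟩
  exact ⟨⟨hab, fun h => hca (hbc h)⟩, ⟨hbc, fun h => hab (hca h)⟩⟩
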